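/- (Theorem 1: convergence of Compositional-SVRG-1) Define β_1 = 1/K + (16 γ B_G² L_F²/μ_f + 4 γ² B_G² L_F²) · (8 B_G²/A) + 10 γ² L_f² and β_2 = 7 μ_f γ/4 − (16 γ B_G² L_F²/μ_f + 4 γ² B_G² L_F²) · (8 B_G²/A) − 8 γ² L_f², and assume β_2 > 0. Then the iterates of one Compositional-SVRG-1 epoch satisfy (1/K) Σ_{k=0}^{K−1} E‖x_k − x*‖² ≤ (β_1/β_2) · E‖x̃ − x*‖². -/

import Mathlib

open MeasureTheory ProbabilityTheory
open scoped BigOperators RealInnerProductSpace ENNReal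

noncomputable section

/-- `G(x) = (1/m) ∑ⱼ Gⱼ(x)`. -/
def Gbar {N M m : ℕ} (Gc : Fin m → EuclideanSpace ℝ (Fin N) → EuclideanSpace ℝ (Fin M))
    (x : EuclideanSpace ℝ (Fin N)) : EuclideanSpace ℝ (Fin M) :=
  (m : ℝ)⁻¹ • ∑ j, Gc j x

/-- `∂G(x) = (1/m) ∑ⱼ ∂Gⱼ(x)`. -/
def DGbar {N M m : ℕ}
    (DG : Fin m → EuclideanSpace ℝ (Fin N) → (EuclideanSpace ℝ (Fin N) →L[ℝ] EuclideanSpace ℝ (Fin M)))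
    (x : EuclideanSpace ℝ (Fin N)) : EuclideanSpace ℝ (Fin N) →L[ℝ] EuclideanSpace ℝ (Fin M) :=
  (m : ℝ)⁻¹ • ∑ j, DG j x

/-- `∇F(y) = (1/n) ∑ᵢ ∇Fᵢ(y)`. -/
def gradFbar {M n : ℕ} (gF : Fin n → EuclideanSpace ℝ (Fin M) → EuclideanSpace ℝ (Fin M))
    (y : EuclideanSpace ℝ (Fin M)) : EuclideanSpace ℝ (Fin M) :=
  (n : ℝ)⁻¹ • ∑ i, gF i y

/-- `f(x) = F(G(x)) = (1/n) ∑ᵢ Fᵢ(G(x))`. -/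
def fObj {N M m n : ℕ} (Gc : Fin m → EuclideanSpace ℝ (Fin N) → EuclideanSpace ℝ (Fin M))
    (Fc : Fin n → EuclideanSpace ℝ (Fin M) → ℝ) (x : EuclideanSpace ℝ (Fin N)) : ℝ :=
  (n : ℝ)⁻¹ * ∑ i, Fc i (Gbar Gc x)

/-- `∇f(x) = (∂G(x))ᵀ ∇F(G(x))` (chain rule). -/
def gradf {N M m n : ℕ} (Gc : Fin m → EuclideanSpace ℝ (Fin N) → EuclideanSpace ℝ (Fin M))
    (DG : Fin m → EuclideanSpace ℝ (Fin N) → (EuclideanSpace ℝ (Fin N) →L[ℝ] EuclideanSpace ℝ (Fin M)))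
    (gF : Fin n → EuclideanSpace ℝ (Fin M) → EuclideanSpace ℝ (Fin M))
    (x : EuclideanSpace ℝ (Fin N)) : EuclideanSpace ℝ (Fin N) :=
  ContinuousLinearMap.adjoint (DGbar DG x) (gradFbar gF (Gbar Gc x))

section FiniteAverages

open Finset

lemma Fintype.expect_expect_update {κ T : Type*} [Fintype κ] [DecidableEq κ] [Fintype T]
    [Nonempty T] (k : κ) (g : (κ → T) → ℝ) :
    𝔼 θ, 𝔼 t, g (Function.update θ k t) = 𝔼 θ, g θ := by
  classical
  let e : (κ → T) × T → (κ → T) × T := fun p => (Function.update p.1 k p.2, p.1 k)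
  have he : Function.Involutive e := fun p => by simp [e]
  calc 𝔼 θ, 𝔼 t, g (Function.update θ k t)
      = 𝔼 p : (κ → T) × T, g (e p).1 := by
        rw [← univ_product_univ, expect_product]
    _ = 𝔼 p : (κ → T) × T, g p.1 :=
        Fintype.expect_equiv he.toPerm _ _ fun _ => rfl
    _ = 𝔼 θ, g θ := by
        rw [← univ_product_univ, expect_product]
        simp only [Fintype.expect_const]

variable {E : Type*} [NormedAddCommGroup E] [InnerProductSpace ℝ E]

lemma expect_norm_sq_sum_of_sum_eq_zero {ι : Type*} [Fintype ι] [Nonempty ι] (U : ι → E)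
    (hU : ∑ c, U c = 0) (A : ℕ) :
    𝔼 a : Fin A → ι, ‖∑ l, U (a l)‖ ^ 2 = A * 𝔼 c, ‖U c‖ ^ 2 := by
  induction A with
  | zero => simp
  | succ A ih =>
    have hcross : ∀ v : E, 𝔼 c, 2 * ⟪U c, v⟫ = 0 := fun v => by
      rw [← mul_expect, Fintype.expect_eq_sum_div_card, ← sum_inner, hU]
      simp
    calc 𝔼 a : Fin (A + 1) → ι, ‖∑ l, U (a l)‖ ^ 2
        = 𝔼 p : ι × (Fin A → ι), ‖U p.1 + ∑ l, U (p.2 l)‖ ^ 2 := by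
          refine (Fintype.expect_equiv (Fin.consEquiv fun _ => ι) _ _ fun p => ?_).symm
          simp [Fin.consEquiv, Fin.sum_univ_succ]
      _ = 𝔼 a : Fin A → ι, 𝔼 c, ‖U c + ∑ l, U (a l)‖ ^ 2 := by
          rw [← univ_product_univ, expect_product, expect_comm]
      _ = 𝔼 a : Fin A → ι, (𝔼 c, ‖U c‖ ^ 2 + ‖∑ l, U (a l)‖ ^ 2) := by
          refine expect_congr rfl fun a _ => ?_
          simp only [norm_add_sq_real, expect_add_distrib, hcross, Fintype.expect_const, add_zero]
      _ = ((A + 1 : ℕ) : ℝ) * 𝔼 c, ‖U c‖ ^ 2 := by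
          rw [expect_add_distrib, Fintype.expect_const, ih]
          push_cast
          ring

lemma expect_norm_sub_mean_sq_le {ι : Type*} [Fintype ι] [Nonempty ι] (Y : ι → E) :
    𝔼 c, ‖Y c - (Fintype.card ι : ℝ)⁻¹ • ∑ d, Y d‖ ^ 2 ≤ 𝔼 c, ‖Y c‖ ^ 2 := by
  set y := (Fintype.card ι : ℝ)⁻¹ • ∑ d, Y d with hy
  have hmean : 𝔼 c, ⟪Y c, y⟫ = ‖y‖ ^ 2 := by
    rw [Fintype.expect_eq_sum_div_card, ← sum_inner, ← real_inner_self_eq_norm_sq]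
    nth_rw 2 [hy]
    rw [real_inner_smul_left, div_eq_inv_mul]
  simp only [norm_sub_sq_real, expect_add_distrib, expect_sub_distrib, Fintype.expect_const,
    ← mul_expect, hmean]
  nlinarith [sq_nonneg ‖y‖]

lemma expect_norm_minibatch_sub_mean_sq_le {ι : Type*} [Fintype ι] [Nonempty ι] (Y : ι → E)
    {A : ℕ} (hA : 1 ≤ A) :
    𝔼 a : Fin A → ι, ‖(A : ℝ)⁻¹ • ∑ l, Y (a l) - (Fintype.card ι : ℝ)⁻¹ • ∑ d, Y d‖ ^ 2
      ≤ (A : ℝ)⁻¹ * 𝔼 c, ‖Y c‖ ^ 2 := by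
  have hA0 : (A : ℝ) ≠ 0 := by positivity
  have hc0 : (Fintype.card ι : ℝ) ≠ 0 := by positivity
  set y := (Fintype.card ι : ℝ)⁻¹ • ∑ d, Y d with hy
  have hsum : ∑ c, (Y c - y) = 0 := by
    rw [sum_sub_distrib, sum_const, card_univ, ← Nat.cast_smul_eq_nsmul ℝ, hy,
      smul_inv_smul₀ hc0, sub_self]
  have hrw : ∀ a : Fin A → ι, ‖(A : ℝ)⁻¹ • ∑ l, Y (a l) - y‖ ^ 2
      = (A : ℝ)⁻¹ ^ 2 * ‖∑ l, (Y (a l) - y)‖ ^ 2 := fun a => by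
    rw [← mul_pow, ← norm_smul_of_nonneg (by positivity), sum_sub_distrib, sum_const, card_univ,
      Fintype.card_fin, ← Nat.cast_smul_eq_nsmul ℝ, smul_sub, inv_smul_smul₀ hA0]
  simp only [hrw]
  rw [← mul_expect, expect_norm_sq_sum_of_sum_eq_zero _ hsum, ← mul_assoc]
  have : (A : ℝ)⁻¹ ^ 2 * A = (A : ℝ)⁻¹ := by field_simp
  rw [this]
  exact mul_le_mul_of_nonneg_left (expect_norm_sub_mean_sq_le Y) (by positivity)

end FiniteAverages

section Objective

open Finset

variable {N M m n : ℕ}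
  {Gc : Fin m → EuclideanSpace ℝ (Fin N) → EuclideanSpace ℝ (Fin M)}
  {DG : Fin m → EuclideanSpace ℝ (Fin N) →
    (EuclideanSpace ℝ (Fin N) →L[ℝ] EuclideanSpace ℝ (Fin M))}
  {gF : Fin n → EuclideanSpace ℝ (Fin M) → EuclideanSpace ℝ (Fin M)}
  {Fc : Fin n → EuclideanSpace ℝ (Fin M) → ℝ} {Lf μf : ℝ}

lemma inner_gradf (x v : EuclideanSpace ℝ (Fin N)) :
    ⟪gradf Gc DG gF x, v⟫
      = 𝔼 p : Fin n × Fin m, ⟪ContinuousLinearMap.adjoint (DG p.2 x) (gF p.1 (Gbar Gc x)), v⟫ := by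
  simp only [gradf, DGbar, gradFbar, ContinuousLinearMap.adjoint_inner_left,
    Fintype.expect_eq_sum_div_card, Fintype.card_prod, Fintype.card_fin, Fintype.sum_prod_type,
    ← inner_sum, ← sum_inner, smul_apply, _root_.sum_apply,
    real_inner_smul_left, real_inner_smul_right]
  push_cast
  ring

lemma norm_gradf_sub_le (hm : 0 < m) (hn : 0 < n) (hLf : 0 < Lf)
    (hLfb : ∀ (x y : EuclideanSpace ℝ (Fin N)) (i : Fin n) (j : Fin m),
      ‖ContinuousLinearMap.adjoint (DG j x) (gF i (Gbar Gc x))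
        - ContinuousLinearMap.adjoint (DG j y) (gF i (Gbar Gc y))‖ ≤ Lf * ‖x - y‖)
    (x y : EuclideanSpace ℝ (Fin N)) :
    ‖gradf Gc DG gF x - gradf Gc DG gF y‖ ≤ Lf * ‖x - y‖ := by
  have : NeZero m := ⟨hm.ne'⟩
  have : NeZero n := ⟨hn.ne'⟩
  set d := gradf Gc DG gF x - gradf Gc DG gF y with hd
  have h : ‖d‖ ^ 2 ≤ Lf * ‖x - y‖ * ‖d‖ := by
    rw [← real_inner_self_eq_norm_sq]
    nth_rw 1 [hd]
    rw [inner_sub_left, inner_gradf, inner_gradf, ← expect_sub_distrib]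
    refine expect_le univ_nonempty fun p _ => ?_
    rw [← inner_sub_left]
    exact (real_inner_le_norm _ _).trans (by gcongr; exact hLfb x y p.1 p.2)
  rcases (norm_nonneg d).eq_or_lt with h0 | h0
  · rw [← h0]; positivity
  · exact le_of_mul_le_mul_right (by linarith [sq ‖d‖]) h0

lemma gradf_eq_zero_of_isMin (hμf : 0 < μf) (hLf : 0 < Lf)
    (hlip : ∀ x y, ‖gradf Gc DG gF x - gradf Gc DG gF y‖ ≤ Lf * ‖x - y‖)
    (hsc : ∀ x y : EuclideanSpace ℝ (Fin N),
      fObj Gc Fc y ≥ fObj Gc Fc x + ⟪gradf Gc DG gF x, y - x⟫ + μf / 2 * ‖y - x‖ ^ 2)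
    {xstar : EuclideanSpace ℝ (Fin N)} (hxstar : ∀ x, fObj Gc Fc xstar ≤ fObj Gc Fc x) :
    gradf Gc DG gF xstar = 0 := by
  set g := gradf Gc DG gF xstar with hg
  set s : ℝ := (2 * Lf)⁻¹ with hs
  have hs0 : 0 < s := by positivity
  set y := xstar - s • g with hy
  have h1 := hsc y xstar
  have h2 := hxstar y
  have h3 : xstar - y = s • g := by simp [hy]
  rw [h3, real_inner_smul_right] at h1
  have h4 : ⟪gradf Gc DG gF y, g⟫ ≤ 0 := by
    have : 0 ≤ μf / 2 * ‖s • g‖ ^ 2 := by positivity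
    by_contra! hpos
    have := mul_pos hs0 hpos
    linarith
  have h5 : ⟪g - gradf Gc DG gF y, g⟫ ≤ 2⁻¹ * ‖g‖ ^ 2 := by
    refine (real_inner_le_norm _ _).trans ?_
    have := hlip xstar y
    rw [h3, norm_smul_of_nonneg hs0.le, ← hg] at this
    calc _ ≤ Lf * (s * ‖g‖) * ‖g‖ := by gcongr
      _ = 2⁻¹ * ‖g‖ ^ 2 := by rw [hs]; field_simp
  rw [inner_sub_left, real_inner_self_eq_norm_sq] at h5
  have h6 : ‖g‖ ^ 2 = 0 := le_antisymm (by linarith) (by positivity)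
  simpa using h6

lemma mul_norm_sub_sq_le_inner_gradf
    (hsc : ∀ x y : EuclideanSpace ℝ (Fin N),
      fObj Gc Fc y ≥ fObj Gc Fc x + ⟪gradf Gc DG gF x, y - x⟫ + μf / 2 * ‖y - x‖ ^ 2)
    {xstar : EuclideanSpace ℝ (Fin N)} (hgrad : gradf Gc DG gF xstar = 0)
    (x : EuclideanSpace ℝ (Fin N)) :
    μf * ‖x - xstar‖ ^ 2 ≤ ⟪gradf Gc DG gF x, x - xstar⟫ := by
  have h1 := hsc x xstar
  have h2 := hsc xstar x
  rw [hgrad, inner_zero_left] at h2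
  rw [← neg_sub x xstar, inner_neg_right, norm_neg] at h1
  linarith

end Objective

section SvrgStep

open Finset

lemma norm_sub_smul_add_sub_sq_le {E : Type*} [NormedAddCommGroup E] [InnerProductSpace ℝ E]
    {D H x xstar : E} {b q γ μf Lf : ℝ} (hγ : 0 < γ) (hμf : 0 < μf)
    (hD : ‖D‖ ≤ b) (hH : ‖H‖ ≤ Lf * (‖x - xstar‖ + 2 * q)) :
    ‖x - γ • (D + H) - xstar‖ ^ 2
      ≤ (1 + μf * γ / 4 + 8 * γ ^ 2 * Lf ^ 2) * ‖x - xstar‖ ^ 2 - 2 * γ * ⟪H, x - xstar⟫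
        + (4 * γ / μf + 16 * γ ^ 2) * b ^ 2 + 10 * γ ^ 2 * Lf ^ 2 * q ^ 2 := by
  set p := ‖x - xstar‖ with hp
  have hp0 : 0 ≤ p := norm_nonneg _
  have hb0 : 0 ≤ b := (norm_nonneg D).trans hD
  have hexp : ‖x - γ • (D + H) - xstar‖ ^ 2
      = p ^ 2 - 2 * γ * ⟪H, x - xstar⟫ - 2 * γ * ⟪D, x - xstar⟫ + γ ^ 2 * ‖D + H‖ ^ 2 := by
    rw [sub_right_comm, norm_sub_sq_real, real_inner_smul_right, real_inner_comm, inner_add_left,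
      norm_smul_of_nonneg hγ.le]
    ring
  have hcross : -(2 * γ * ⟪D, x - xstar⟫) ≤ μf * γ / 4 * p ^ 2 + 4 * γ / μf * b ^ 2 := by
    have h1 : -⟪D, x - xstar⟫ ≤ b * p := by
      rw [← inner_neg_left]
      refine (real_inner_le_norm _ _).trans ?_
      rw [norm_neg]
      gcongr
    have h2 : 2 * (b * p) ≤ μf / 4 * p ^ 2 + 4 / μf * b ^ 2 := by
      have h3 : μf / 4 * p ^ 2 + 4 / μf * b ^ 2 - 2 * (b * p)
          = μf / 4 * (p - 4 / μf * b) ^ 2 := by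
        field_simp
        ring
      have h4 : 0 ≤ μf / 4 * (p - 4 / μf * b) ^ 2 := by positivity
      linarith
    calc -(2 * γ * ⟪D, x - xstar⟫) = γ * (2 * -⟪D, x - xstar⟫) := by ring
      _ ≤ γ * (μf / 4 * p ^ 2 + 4 / μf * b ^ 2) := by
        gcongr
        linarith
      _ = _ := by ring
  have hsq : ‖D + H‖ ^ 2 ≤ 16 * b ^ 2 + 8 * (Lf * p) ^ 2 + 10 * (Lf * q) ^ 2 := by
    have h1 : ‖D + H‖ ≤ b + Lf * p + 2 * (Lf * q) := by
      linarith [norm_add_le D H]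
    calc ‖D + H‖ ^ 2 ≤ (b + Lf * p + 2 * (Lf * q)) ^ 2 := by gcongr
      _ ≤ _ := by
        nlinarith [sq_nonneg (3 * b - Lf * p), sq_nonneg (3 * b - Lf * q),
          sq_nonneg (Lf * p - Lf * q), sq_nonneg b, sq_nonneg (Lf * p), sq_nonneg (Lf * q)]
  have := mul_le_mul_of_nonneg_left hsq (sq_nonneg γ)
  rw [hexp]
  linarith

variable {N M m n A : ℕ}

/-- The stochastic search direction of Compositional-SVRG-1 at the iterate `x` with reference point
`z`, for the inner mini-batch `t.1`, the outer index `t.2.1` and the Jacobian index `t.2.2`. -/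
def svrgDirection (Gc : Fin m → EuclideanSpace ℝ (Fin N) → EuclideanSpace ℝ (Fin M))
    (DG : Fin m → EuclideanSpace ℝ (Fin N) →
      (EuclideanSpace ℝ (Fin N) →L[ℝ] EuclideanSpace ℝ (Fin M)))
    (gF : Fin n → EuclideanSpace ℝ (Fin M) → EuclideanSpace ℝ (Fin M))
    (z x : EuclideanSpace ℝ (Fin N)) (t : (Fin A → Fin m) × Fin n × Fin m) :
    EuclideanSpace ℝ (Fin N) :=
  ContinuousLinearMap.adjoint (DG t.2.2 x) (gF t.2.1
      (Gbar Gc z - (A : ℝ)⁻¹ • ∑ l : Fin A, (Gc (t.1 l) z - Gc (t.1 l) x)))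
    - ContinuousLinearMap.adjoint (DG t.2.2 z) (gF t.2.1 (Gbar Gc z))
    + gradf Gc DG gF z

variable {Gc : Fin m → EuclideanSpace ℝ (Fin N) → EuclideanSpace ℝ (Fin M)}
  {DG : Fin m → EuclideanSpace ℝ (Fin N) →
    (EuclideanSpace ℝ (Fin N) →L[ℝ] EuclideanSpace ℝ (Fin M))}
  {gF : Fin n → EuclideanSpace ℝ (Fin M) → EuclideanSpace ℝ (Fin M)} {BG LF Lf μf γ : ℝ}

lemma norm_sub_le_of_jacobian_bound
    (hDG : ∀ (j : Fin m) (x : EuclideanSpace ℝ (Fin N)), HasFDerivAt (Gc j) (DG j x) x)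
    (hBGb : ∀ (j : Fin m) (x : EuclideanSpace ℝ (Fin N)), ‖DG j x‖ ≤ BG)
    (j : Fin m) (x y : EuclideanSpace ℝ (Fin N)) : ‖Gc j x - Gc j y‖ ≤ BG * ‖x - y‖ :=
  convex_univ.norm_image_sub_le_of_norm_hasFDerivWithin_le
    (fun z _ => (hDG j z).hasFDerivWithinAt) (fun z _ => hBGb j z) trivial trivial

lemma expect_norm_inner_estimate_sub_sq_le (hm : 0 < m) (hA : 1 ≤ A)
    (hlip : ∀ j x y, ‖Gc j x - Gc j y‖ ≤ BG * ‖x - y‖) (z x : EuclideanSpace ℝ (Fin N)) :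
    𝔼 a : Fin A → Fin m, ‖Gbar Gc z - (A : ℝ)⁻¹ • ∑ l, (Gc (a l) z - Gc (a l) x)
        - Gbar Gc x‖ ^ 2
      ≤ BG ^ 2 / A * ‖x - z‖ ^ 2 := by
  have : NeZero m := ⟨hm.ne'⟩
  have hA0 : (0 : ℝ) < A := by positivity
  have hrw : ∀ a : Fin A → Fin m,
      Gbar Gc z - (A : ℝ)⁻¹ • ∑ l, (Gc (a l) z - Gc (a l) x) - Gbar Gc x
        = (A : ℝ)⁻¹ • ∑ l, (Gc (a l) x - Gc (a l) z)
          - (Fintype.card (Fin m) : ℝ)⁻¹ • ∑ d, (Gc d x - Gc d z) := fun a => by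
    simp only [Gbar, Fintype.card_fin, sum_sub_distrib, smul_sub]
    abel
  simp only [hrw]
  refine (expect_norm_minibatch_sub_mean_sq_le (fun c => Gc c x - Gc c z) hA).trans ?_
  have h1 : 𝔼 c, ‖Gc c x - Gc c z‖ ^ 2 ≤ (BG * ‖x - z‖) ^ 2 :=
    expect_le univ_nonempty fun c _ => by
      have := hlip c x z
      gcongr
  calc (A : ℝ)⁻¹ * 𝔼 c, ‖Gc c x - Gc c z‖ ^ 2 ≤ (A : ℝ)⁻¹ * (BG * ‖x - z‖) ^ 2 :=
        mul_le_mul_of_nonneg_left h1 (by positivity)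
    _ = _ := by ring

lemma expect_norm_svrg_step_sub_sq_le (hm : 0 < m) (hn : 0 < n) (hA : 1 ≤ A)
    (hBG : 0 < BG) (hBGb : ∀ (j : Fin m) (x : EuclideanSpace ℝ (Fin N)), ‖DG j x‖ ≤ BG)
    (hlip : ∀ j x y, ‖Gc j x - Gc j y‖ ≤ BG * ‖x - y‖)
    (hLFb : ∀ (i : Fin n) (u v : EuclideanSpace ℝ (Fin M)), ‖gF i u - gF i v‖ ≤ LF * ‖u - v‖)
    (hLf : 0 < Lf)
    (hLfb : ∀ (x y : EuclideanSpace ℝ (Fin N)) (i : Fin n) (j : Fin m),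
      ‖ContinuousLinearMap.adjoint (DG j x) (gF i (Gbar Gc x))
        - ContinuousLinearMap.adjoint (DG j y) (gF i (Gbar Gc y))‖ ≤ Lf * ‖x - y‖)
    (hμf : 0 < μf) (hγ : 0 < γ) {xstar : EuclideanSpace ℝ (Fin N)}
    (hgrad : gradf Gc DG gF xstar = 0)
    (hmono : ∀ x, μf * ‖x - xstar‖ ^ 2 ≤ ⟪gradf Gc DG gF x, x - xstar⟫)
    (z x : EuclideanSpace ℝ (Fin N)) :
    𝔼 t : (Fin A → Fin m) × Fin n × Fin m,
        ‖x - γ • svrgDirection Gc DG gF z x t - xstar‖ ^ 2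
      ≤ (1 - (7 * μf * γ / 4
          - (16 * γ * BG ^ 2 * LF ^ 2 / μf + 4 * γ ^ 2 * BG ^ 2 * LF ^ 2) * (8 * BG ^ 2 / (A : ℝ))
          - 8 * γ ^ 2 * Lf ^ 2)) * ‖x - xstar‖ ^ 2
        + ((16 * γ * BG ^ 2 * LF ^ 2 / μf + 4 * γ ^ 2 * BG ^ 2 * LF ^ 2) * (8 * BG ^ 2 / (A : ℝ))
          + 10 * γ ^ 2 * Lf ^ 2) * ‖z - xstar‖ ^ 2 := by
  have : NeZero m := ⟨hm.ne'⟩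
  have : NeZero n := ⟨hn.ne'⟩
  set p := ‖x - xstar‖
  set q := ‖z - xstar‖
  let h : Fin n × Fin m → EuclideanSpace ℝ (Fin N) → EuclideanSpace ℝ (Fin N) :=
    fun s y => ContinuousLinearMap.adjoint (DG s.2 y) (gF s.1 (Gbar Gc y))
  let Ghat : (Fin A → Fin m) → EuclideanSpace ℝ (Fin M) :=
    fun a => Gbar Gc z - (A : ℝ)⁻¹ • ∑ l, (Gc (a l) z - Gc (a l) x)
  let H : Fin n × Fin m → EuclideanSpace ℝ (Fin N) := fun s => h s x - h s z + gradf Gc DG gF z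
  have hxz : ‖x - z‖ ≤ p + q := by
    rw [← sub_sub_sub_cancel_right x z xstar]
    exact norm_sub_le _ _
  have hpt : ∀ t : (Fin A → Fin m) × Fin n × Fin m,
      ‖x - γ • svrgDirection Gc DG gF z x t - xstar‖ ^ 2
        ≤ (1 + μf * γ / 4 + 8 * γ ^ 2 * Lf ^ 2) * p ^ 2 - 2 * γ * ⟪H t.2, x - xstar⟫
          + (4 * γ / μf + 16 * γ ^ 2) * (BG * LF) ^ 2 * ‖Ghat t.1 - Gbar Gc x‖ ^ 2
          + 10 * γ ^ 2 * Lf ^ 2 * q ^ 2 := fun t => by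
    have hsplit : svrgDirection Gc DG gF z x t
        = ContinuousLinearMap.adjoint (DG t.2.2 x) (gF t.2.1 (Ghat t.1) - gF t.2.1 (Gbar Gc x))
          + H t.2 := by
      simp only [svrgDirection, H, h, Ghat, map_sub]
      abel
    have hD : ‖ContinuousLinearMap.adjoint (DG t.2.2 x)
        (gF t.2.1 (Ghat t.1) - gF t.2.1 (Gbar Gc x))‖
          ≤ BG * LF * ‖Ghat t.1 - Gbar Gc x‖ := by
      refine (ContinuousLinearMap.le_opNorm _ _).trans ?_
      rw [LinearIsometryEquiv.norm_map, mul_assoc]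
      exact mul_le_mul (hBGb _ _) (hLFb _ _ _) (norm_nonneg _) hBG.le
    have hH : ‖H t.2‖ ≤ Lf * (p + 2 * q) := by
      have h1 : ‖h t.2 x - h t.2 z‖ ≤ Lf * (p + q) :=
        (hLfb x z t.2.1 t.2.2).trans (by gcongr)
      have h2 : ‖gradf Gc DG gF z‖ ≤ Lf * q := by
        simpa [hgrad] using norm_gradf_sub_le hm hn hLf hLfb z xstar
      linarith [norm_add_le (h t.2 x - h t.2 z) (gradf Gc DG gF z)]
    rw [hsplit, mul_assoc (4 * γ / μf + 16 * γ ^ 2), ← mul_pow]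
    exact norm_sub_smul_add_sub_sq_le hγ hμf hD hH
  have hHavg : 𝔼 t : (Fin A → Fin m) × Fin n × Fin m, ⟪H t.2, x - xstar⟫
      = ⟪gradf Gc DG gF x, x - xstar⟫ := by
    rw [← univ_product_univ, expect_product]
    simp only [H, inner_add_left, inner_sub_left, expect_add_distrib, expect_sub_distrib,
      Fintype.expect_const, h, ← inner_gradf]
    ring
  have hGavg : 𝔼 t : (Fin A → Fin m) × Fin n × Fin m, ‖Ghat t.1 - Gbar Gc x‖ ^ 2
      ≤ 2 * BG ^ 2 / A * (p ^ 2 + q ^ 2) := by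
    rw [← univ_product_univ, expect_product]
    simp only [Fintype.expect_const]
    refine (expect_norm_inner_estimate_sub_sq_le hm hA hlip z x).trans ?_
    calc BG ^ 2 / A * ‖x - z‖ ^ 2 ≤ BG ^ 2 / A * (p + q) ^ 2 := by gcongr
      _ ≤ BG ^ 2 / A * (2 * (p ^ 2 + q ^ 2)) := by gcongr; nlinarith [sq_nonneg (p - q)]
      _ = _ := by ring
  have hcoef : (4 * γ / μf + 16 * γ ^ 2) * (BG * LF) ^ 2 * (2 * BG ^ 2 / A * (p ^ 2 + q ^ 2))
      ≤ (16 * γ * BG ^ 2 * LF ^ 2 / μf + 4 * γ ^ 2 * BG ^ 2 * LF ^ 2) * (8 * BG ^ 2 / (A : ℝ))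
        * (p ^ 2 + q ^ 2) := by
    have h1 : 0 ≤ 120 * (γ * BG ^ 2 * LF ^ 2 / μf * (BG ^ 2 / A)) * (p ^ 2 + q ^ 2) := by
      positivity
    linear_combination h1
  calc _ ≤ 𝔼 t : (Fin A → Fin m) × Fin n × Fin m,
        ((1 + μf * γ / 4 + 8 * γ ^ 2 * Lf ^ 2) * p ^ 2 - 2 * γ * ⟪H t.2, x - xstar⟫
          + (4 * γ / μf + 16 * γ ^ 2) * (BG * LF) ^ 2 * ‖Ghat t.1 - Gbar Gc x‖ ^ 2
          + 10 * γ ^ 2 * Lf ^ 2 * q ^ 2) := expect_le_expect fun t _ => hpt t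
    _ = (1 + μf * γ / 4 + 8 * γ ^ 2 * Lf ^ 2) * p ^ 2 - 2 * γ * ⟪gradf Gc DG gF x, x - xstar⟫
          + (4 * γ / μf + 16 * γ ^ 2) * (BG * LF) ^ 2
            * (𝔼 t : (Fin A → Fin m) × Fin n × Fin m, ‖Ghat t.1 - Gbar Gc x‖ ^ 2)
          + 10 * γ ^ 2 * Lf ^ 2 * q ^ 2 := by
      simp only [expect_add_distrib, expect_sub_distrib, Fintype.expect_const, ← mul_expect, hHavg]
    _ ≤ _ := by
      have h1 := mul_le_mul_of_nonneg_left (hmono x) (show 0 ≤ 2 * γ by positivity)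
      have h2 := mul_le_mul_of_nonneg_left hGavg
        (show 0 ≤ (4 * γ / μf + 16 * γ ^ 2) * (BG * LF) ^ 2 by positivity)
      linarith

end SvrgStep

section RandomIteration

open Finset

variable {S T : Type*} {K : ℕ}

/-- The iterates of `x ↦ step x t`, where step number `k` uses the parameter `θ k`; the sequence is
constant after the last of the `K` steps. -/
def paramIter (step : S → T → S) (x₀ : S) (θ : Fin K → T) : ℕ → S
  | 0 => x₀
  | k + 1 => if hk : k < K then step (paramIter step x₀ θ k) (θ ⟨k, hk⟩)
      else paramIter step x₀ θ k

lemma paramIter_succ (step : S → T → S) (x₀ : S) (θ : Fin K → T) (k : Fin K) :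
    paramIter step x₀ θ (k + 1) = step (paramIter step x₀ θ k) (θ k) := by
  simp [paramIter]

lemma paramIter_update (step : S → T → S) (x₀ : S) (θ : Fin K → T) (k : Fin K) (t : T)
    {r : ℕ} (hr : r ≤ k) :
    paramIter step x₀ (Function.update θ k t) r = paramIter step x₀ θ r := by
  induction r with
  | zero => rfl
  | succ r ih =>
    have hrK : r < K := by omega
    have hne : (⟨r, hrK⟩ : Fin K) ≠ k := fun h => by
      have := congrArg Fin.val h
      simp only at this
      omega
    simp [paramIter, hrK, ih (by omega), Function.update_of_ne hne]

lemma continuous_paramIter [TopologicalSpace S] {step : S → S → T → S}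
    (hstep : ∀ t, Continuous fun p : S × S => step p.1 p.2 t) (θ : Fin K → T) (k : ℕ) :
    Continuous fun z => paramIter (step z) z θ k := by
  induction k with
  | zero => exact continuous_id
  | succ k ih =>
    by_cases hk : k < K
    · simp only [paramIter, hk, dite_true]
      exact (hstep (θ ⟨k, hk⟩)).comp (continuous_id.prodMk ih)
    · simpa [paramIter, hk] using ih

variable [Fintype T] [Nonempty T] {step : S → T → S} {V : S → ℝ} {β c : ℝ}

lemma expect_paramIter_succ_le (hstep : ∀ x, 𝔼 t, V (step x t) ≤ (1 - β) * V x + c)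
    (x₀ : S) (k : Fin K) :
    𝔼 θ : Fin K → T, V (paramIter step x₀ θ (k + 1))
      ≤ (1 - β) * (𝔼 θ : Fin K → T, V (paramIter step x₀ θ k)) + c := by
  rw [← Fintype.expect_expect_update k]
  simp only [paramIter_succ, paramIter_update _ _ _ k _ le_rfl, Function.update_self]
  refine (expect_le_expect fun θ _ => hstep _).trans_eq ?_
  rw [expect_add_distrib, Fintype.expect_const, mul_expect]

lemma mul_sum_expect_paramIter_le (hV : ∀ x, 0 ≤ V x)
    (hstep : ∀ x, 𝔼 t, V (step x t) ≤ (1 - β) * V x + c) (x₀ : S) :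
    β * ∑ k ∈ range K, 𝔼 θ : Fin K → T, V (paramIter step x₀ θ k) ≤ V x₀ + K * c := by
  have htel : ∀ r ≤ K, β * ∑ k ∈ range r, 𝔼 θ : Fin K → T, V (paramIter step x₀ θ k)
      + 𝔼 θ : Fin K → T, V (paramIter step x₀ θ r) ≤ V x₀ + r * c := by
    intro r
    induction r with
    | zero => simp [paramIter]
    | succ r ih =>
      intro hr
      have h1 := ih (by omega)
      have h2 := expect_paramIter_succ_le hstep x₀ (⟨r, by omega⟩ : Fin K)
      rw [sum_range_succ, mul_add]
      push_cast
      linarith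
  have h1 := htel K le_rfl
  have h2 : 0 ≤ 𝔼 θ : Fin K → T, V (paramIter step x₀ θ K) := expect_nonneg fun _ _ => hV _
  linarith

end RandomIteration

section Continuity

variable {N M m n A : ℕ}
  {Gc : Fin m → EuclideanSpace ℝ (Fin N) → EuclideanSpace ℝ (Fin M)}
  {DG : Fin m → EuclideanSpace ℝ (Fin N) →
    (EuclideanSpace ℝ (Fin N) →L[ℝ] EuclideanSpace ℝ (Fin M))}
  {gF : Fin n → EuclideanSpace ℝ (Fin M) → EuclideanSpace ℝ (Fin M)}

lemma continuous_svrgDirection (hGc : ∀ j, Continuous (Gc j)) (hDG : ∀ j, Continuous (DG j))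
    (hgF : ∀ i, Continuous (gF i)) (t : (Fin A → Fin m) × Fin n × Fin m) :
    Continuous fun p : EuclideanSpace ℝ (Fin N) × EuclideanSpace ℝ (Fin N) =>
      svrgDirection Gc DG gF p.1 p.2 t := by
  have hadj : ∀ {X : Type} [TopologicalSpace X]
      {L : X → EuclideanSpace ℝ (Fin N) →L[ℝ] EuclideanSpace ℝ (Fin M)}
      {v : X → EuclideanSpace ℝ (Fin M)}, Continuous L → Continuous v →
      Continuous fun y => ContinuousLinearMap.adjoint (L y) (v y) := fun hL hv =>
    (ContinuousLinearMap.adjoint.continuous.comp hL).clm_apply hv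
  have hGbar : Continuous (Gbar Gc) := by
    unfold Gbar
    fun_prop
  have hDGbar : Continuous (DGbar DG) := by
    unfold DGbar
    fun_prop
  have hgFbar : Continuous (gradFbar gF) := by
    unfold gradFbar
    fun_prop
  have hgradf : Continuous (gradf Gc DG gF) := hadj hDGbar (hgFbar.comp hGbar)
  unfold svrgDirection
  refine ((hadj (by fun_prop) (by fun_prop)).sub (hadj (by fun_prop) (by fun_prop))).add
    (by fun_prop)

end Continuity

section RandomIndices

variable {Ω : Type*} [MeasurableSpace Ω] {μ : Measure Ω}

lemma integral_comp_eq_expect_integral_of_indepFun [IsProbabilityMeasure μ]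
    {Θ E : Type*} [Fintype Θ] [MeasurableSpace Θ] [MeasurableSingletonClass Θ]
    [MeasurableSpace E] [TopologicalSpace E] [BorelSpace E]
    {J : Ω → Θ} {Z : Ω → E} (hJ : Measurable J) (hind : IndepFun J Z μ)
    {w : ℝ≥0∞} (hw : ∀ θ, μ (J ⁻¹' {θ}) = w)
    {Φ : Θ → E → ℝ} (hΦ : ∀ θ, Continuous (Φ θ)) (hint : ∀ θ, Integrable (fun ω => Φ θ (Z ω)) μ) :
    ∫ ω, Φ (J ω) (Z ω) ∂μ = 𝔼 θ, ∫ ω, Φ θ (Z ω) ∂μ := by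
  classical
  have hmeas : ∀ θ, MeasurableSet (J ⁻¹' {θ}) := fun θ => hJ (measurableSet_singleton θ)
  have hcard : (Fintype.card Θ : ℝ) * w.toReal = 1 := by
    have h1 : ∑ θ, μ (J ⁻¹' {θ}) = 1 := by
      rw [← measure_biUnion_finset (fun θ _ θ' _ h => ?_) fun θ _ => hmeas θ]
      · rw [← measure_univ (μ := μ)]
        congr 1
        ext ω
        simp
      · exact Disjoint.preimage J (Set.disjoint_singleton.2 h)
    simp only [hw, Finset.sum_const, Finset.card_univ, nsmul_eq_mul] at h1
    simpa using congrArg ENNReal.toReal h1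
  have hpiece : ∀ θ, ∫ ω, (J ⁻¹' {θ}).indicator 1 ω * Φ θ (Z ω) ∂μ
      = w.toReal * ∫ ω, Φ θ (Z ω) ∂μ := fun θ => by
    have hφ : Measurable (({θ} : Set Θ).indicator (1 : Θ → ℝ)) :=
      measurable_one.indicator (measurableSet_singleton θ)
    have h := (hind.comp hφ (hΦ θ).measurable).integral_fun_mul_eq_mul_integral
      (hφ.comp hJ).aestronglyMeasurable (hint θ).aestronglyMeasurable
    have hcomp : ({θ} : Set Θ).indicator (1 : Θ → ℝ) ∘ J = (J ⁻¹' {θ}).indicator 1 := rfl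
    rw [hcomp, integral_indicator_one (hmeas θ), measureReal_def, hw] at h
    exact h
  calc ∫ ω, Φ (J ω) (Z ω) ∂μ
      = ∫ ω, ∑ θ, (J ⁻¹' {θ}).indicator 1 ω * Φ θ (Z ω) ∂μ := by
        refine integral_congr_ae (.of_forall fun ω => ?_)
        simp [Set.indicator_apply]
    _ = ∑ θ, ∫ ω, (J ⁻¹' {θ}).indicator 1 ω * Φ θ (Z ω) ∂μ := by
        refine integral_finsetSum _ fun θ _ => ?_
        refine ((hint θ).indicator (hmeas θ)).congr (.of_forall fun ω => ?_)
        simp [Set.indicator_apply]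
    _ = w.toReal * ∑ θ, ∫ ω, Φ θ (Z ω) ∂μ := by
        simp only [hpiece, Finset.mul_sum]
    _ = 𝔼 θ, ∫ ω, Φ θ (Z ω) ∂μ := by
        rw [Fintype.expect_eq_sum_div_card, eq_div_iff (left_ne_zero_of_mul_eq_one hcard)]
        linear_combination (∑ θ, ∫ ω, Φ θ (Z ω) ∂μ) * hcard

variable {K A m n : ℕ}

/-- The choices of all indices of an epoch, listed as natural numbers. -/
def indexCode (θ : Fin K → (Fin A → Fin m) × Fin n × Fin m) (p : Fin K × Fin (A + 2)) : ℕ :=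
  if h : (p.2 : ℕ) < A then ((θ p.1).1 ⟨(p.2 : ℕ), h⟩ : ℕ)
  else if (p.2 : ℕ) = A then ((θ p.1).2.1 : ℕ) else ((θ p.1).2.2 : ℕ)

lemma indexCode_injective :
    Function.Injective (indexCode : (Fin K → (Fin A → Fin m) × Fin n × Fin m) → _) := by
  intro θ θ' h
  funext k
  have hk : ∀ r : Fin (A + 2), indexCode θ (k, r) = indexCode θ' (k, r) := fun r => by rw [h]
  refine Prod.ext (funext fun l => Fin.ext ?_) (Prod.ext (Fin.ext ?_) (Fin.ext ?_))
  · simpa [indexCode] using hk ⟨l, by omega⟩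
  · simpa [indexCode] using hk ⟨A, by omega⟩
  · simpa [indexCode] using hk ⟨A + 1, by omega⟩

variable {a : Fin K → Fin A → Ω → Fin m} {i : Fin K → Ω → Fin n} {j : Fin K → Ω → Fin m}

/-- Under uniformity and mutual independence, all outcomes of the indices of an epoch are equally
likely. -/
lemma measure_indices_eq
    (ha_unif : ∀ (k : Fin K) (l : Fin A) (c : Fin m), μ {ω | a k l ω = c} = (m : ℝ≥0∞)⁻¹)
    (hi_unif : ∀ (k : Fin K) (c : Fin n), μ {ω | i k ω = c} = (n : ℝ≥0∞)⁻¹)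
    (hj_unif : ∀ (k : Fin K) (c : Fin m), μ {ω | j k ω = c} = (m : ℝ≥0∞)⁻¹)
    (hind : iIndepFun (m := fun _ : Fin K × Fin (A + 2) => (inferInstance : MeasurableSpace ℕ))
      (fun p ω => indexCode (fun k => (fun l => a k l ω, i k ω, j k ω)) p) μ)
    (θ : Fin K → (Fin A → Fin m) × Fin n × Fin m) :
    μ ((fun ω k => ((fun l => a k l ω, i k ω, j k ω) : (Fin A → Fin m) × Fin n × Fin m)) ⁻¹' {θ})
      = ∏ p : Fin K × Fin (A + 2), if (p.2 : ℕ) = A then (n : ℝ≥0∞)⁻¹ else (m : ℝ≥0∞)⁻¹ := by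
  have hset : (fun ω k => ((fun l => a k l ω, i k ω, j k ω) : (Fin A → Fin m) × Fin n × Fin m))
      ⁻¹' {θ} = ⋂ p, (fun ω => indexCode (fun k => (fun l => a k l ω, i k ω, j k ω)) p)
        ⁻¹' {indexCode θ p} := by
    ext ω
    simp only [Set.mem_preimage, Set.mem_singleton_iff, Set.mem_iInter]
    rw [← funext_iff]
    exact indexCode_injective.eq_iff.symm
  rw [hset, hind.meas_iInter fun p => ⟨_, measurableSet_singleton _, rfl⟩]
  refine Finset.prod_congr rfl fun p _ => ?_
  by_cases h1 : (p.2 : ℕ) < A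
  · have h2 : (p.2 : ℕ) ≠ A := h1.ne
    simpa [indexCode, h1, h2, Set.preimage, Fin.val_inj] using ha_unif p.1 ⟨p.2, h1⟩ _
  · by_cases h2 : (p.2 : ℕ) = A
    · simpa [indexCode, h2, Set.preimage, Fin.val_inj] using hi_unif p.1 _
    · simpa [indexCode, h1, h2, Set.preimage, Fin.val_inj] using hj_unif p.1 _

lemma indepFun_indices {E : Type*} [MeasurableSpace E] {Z : Ω → E}
    [Nonempty (Fin K → (Fin A → Fin m) × Fin n × Fin m)]
    (hind : IndepFun (fun ω => indexCode fun k => (fun l => a k l ω, i k ω, j k ω)) Z μ) :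
    IndepFun (fun ω k => ((fun l => a k l ω, i k ω, j k ω) : (Fin A → Fin m) × Fin n × Fin m))
      Z μ := by
  have h := hind.comp (ψ := id) (Measurable.of_discrete (f := Function.invFun
    (indexCode : (Fin K → (Fin A → Fin m) × Fin n × Fin m) → _))) measurable_id
  simpa only [Function.comp_def, Function.leftInverse_invFun indexCode_injective _, id_eq] using h

end RandomIndices

/-- Theorem 1: convergence of one epoch of Compositional-SVRG-1. -/
theorem stmt8
    (N M m n : ℕ) (hN : 0 < N) (hM : 0 < M) (hm : 0 < m) (hn : 0 < n)
    (Gc : Fin m → EuclideanSpace ℝ (Fin N) → EuclideanSpace ℝ (Fin M))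
    (DG : Fin m → EuclideanSpace ℝ (Fin N) → (EuclideanSpace ℝ (Fin N) →L[ℝ] EuclideanSpace ℝ (Fin M)))
    (hGc : ∀ j, ContDiff ℝ 1 (Gc j))
    (hDG : ∀ (j : Fin m) (x : EuclideanSpace ℝ (Fin N)), HasFDerivAt (Gc j) (DG j x) x)
    (Fc : Fin n → EuclideanSpace ℝ (Fin M) → ℝ)
    (gF : Fin n → EuclideanSpace ℝ (Fin M) → EuclideanSpace ℝ (Fin M))
    (hFc : ∀ i, ContDiff ℝ 1 (Fc i))
    (hgF : ∀ (i : Fin n) (y : EuclideanSpace ℝ (Fin M)), HasGradientAt (Fc i) (gF i y) y)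
    (BG : ℝ) (hBG : 0 < BG)
    (hBGb : ∀ (j : Fin m) (x : EuclideanSpace ℝ (Fin N)), ‖DG j x‖ ≤ BG)
    (LF : ℝ) (hLF : 0 < LF)
    (hLFb : ∀ (i : Fin n) (u v : EuclideanSpace ℝ (Fin M)), ‖gF i u - gF i v‖ ≤ LF * ‖u - v‖)
    (Lf : ℝ) (hLf : 0 < Lf)
    (hLfb : ∀ (x y : EuclideanSpace ℝ (Fin N)) (i : Fin n) (j : Fin m),
      ‖ContinuousLinearMap.adjoint (DG j x) (gF i (Gbar Gc x))
        - ContinuousLinearMap.adjoint (DG j y) (gF i (Gbar Gc y))‖ ≤ Lf * ‖x - y‖)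
    (μf : ℝ) (hμf : 0 < μf)
    (hsc : ∀ x y : EuclideanSpace ℝ (Fin N),
      fObj Gc Fc y ≥ fObj Gc Fc x + ⟪gradf Gc DG gF x, y - x⟫ + μf / 2 * ‖y - x‖ ^ 2)
    (xstar : EuclideanSpace ℝ (Fin N)) (hxstar : ∀ x, fObj Gc Fc xstar ≤ fObj Gc Fc x)
    (Ω : Type*) [MeasurableSpace Ω] (μ : Measure Ω) [IsProbabilityMeasure μ]
    (γ : ℝ) (hγpos : 0 < γ) (K : ℕ) (hK : 1 ≤ K) (A : ℕ) (hA : 1 ≤ A)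
    (xt : Ω → EuclideanSpace ℝ (Fin N)) (hxt : MemLp xt 2 μ)
    (a : Fin K → Fin A → Ω → Fin m) (i : Fin K → Ω → Fin n) (j : Fin K → Ω → Fin m)
    (ha_meas : ∀ (k : Fin K) (l : Fin A), Measurable (a k l))
    (hi_meas : ∀ k : Fin K, Measurable (i k)) (hj_meas : ∀ k : Fin K, Measurable (j k))
    (ha_unif : ∀ (k : Fin K) (l : Fin A) (c : Fin m), μ {ω | a k l ω = c} = (m : ℝ≥0∞)⁻¹)
    (hi_unif : ∀ (k : Fin K) (c : Fin n), μ {ω | i k ω = c} = (n : ℝ≥0∞)⁻¹)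
    (hj_unif : ∀ (k : Fin K) (c : Fin m), μ {ω | j k ω = c} = (m : ℝ≥0∞)⁻¹)
    (hidx_indep : iIndepFun (m := fun _ : Fin K × Fin (A + 2) => (inferInstance : MeasurableSpace ℕ))
      (fun p : Fin K × Fin (A + 2) => fun ω =>
        if h : ((p.2 : ℕ)) < A then ((a p.1 ⟨(p.2 : ℕ), h⟩ ω : ℕ))
        else if (p.2 : ℕ) = A then ((i p.1 ω : ℕ)) else ((j p.1 ω : ℕ))) μ)
    (hindep : IndepFun
      (fun ω => fun p : Fin K × Fin (A + 2) =>
        if h : ((p.2 : ℕ)) < A then ((a p.1 ⟨(p.2 : ℕ), h⟩ ω : ℕ))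
        else if (p.2 : ℕ) = A then ((i p.1 ω : ℕ)) else ((j p.1 ω : ℕ)))
      xt μ)
    (x : ℕ → Ω → EuclideanSpace ℝ (Fin N))
    (hx0 : x 0 = xt)
    (hrec : ∀ k, ∀ hk : k < K, x (k + 1) = fun ω =>
      x k ω - γ • (ContinuousLinearMap.adjoint (DG (j ⟨k, hk⟩ ω) (x k ω)) (gF (i ⟨k, hk⟩ ω)
            (Gbar Gc (xt ω) - (A : ℝ)⁻¹ •
              ∑ l : Fin A, (Gc (a ⟨k, hk⟩ l ω) (xt ω) - Gc (a ⟨k, hk⟩ l ω) (x k ω))))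
          - ContinuousLinearMap.adjoint (DG (j ⟨k, hk⟩ ω) (xt ω)) (gF (i ⟨k, hk⟩ ω) (Gbar Gc (xt ω)))
          + gradf Gc DG gF (xt ω)))
 :
    ∀ β1 β2 : ℝ,
      β1 = 1 / (K : ℝ)
          + (16 * γ * BG ^ 2 * LF ^ 2 / μf + 4 * γ ^ 2 * BG ^ 2 * LF ^ 2) * (8 * BG ^ 2 / (A : ℝ))
          + 10 * γ ^ 2 * Lf ^ 2 →
      β2 = 7 * μf * γ / 4
          - (16 * γ * BG ^ 2 * LF ^ 2 / μf + 4 * γ ^ 2 * BG ^ 2 * LF ^ 2) * (8 * BG ^ 2 / (A : ℝ))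
          - 8 * γ ^ 2 * Lf ^ 2 →
      0 < β2 →
      (K : ℝ)⁻¹ * ∑ k ∈ Finset.range K, ∫ ω, ‖x k ω - xstar‖ ^ 2 ∂μ
        ≤ β1 / β2 * ∫ ω, ‖xt ω - xstar‖ ^ 2 ∂μ := by
  intro β1 β2 hβ1 hβ2 hβpos
  have : NeZero m := ⟨hm.ne'⟩
  have : NeZero n := ⟨hn.ne'⟩
  have hK0 : (0 : ℝ) < K := by positivity
  have hgrad : gradf Gc DG gF xstar = 0 :=
    gradf_eq_zero_of_isMin hμf hLf (norm_gradf_sub_le hm hn hLf hLfb) hsc hxstar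
  let step (z y : EuclideanSpace ℝ (Fin N)) (t : (Fin A → Fin m) × Fin n × Fin m) :=
    y - γ • svrgDirection Gc DG gF z y t
  let iter (θ : Fin K → (Fin A → Fin m) × Fin n × Fin m) (k : ℕ) (z : EuclideanSpace ℝ (Fin N)) :=
    paramIter (step z) z θ k
  let J (ω : Ω) (k : Fin K) : (Fin A → Fin m) × Fin n × Fin m := (fun l => a k l ω, i k ω, j k ω)
  have hJ : Measurable J := measurable_pi_lambda _ fun k =>
    (measurable_pi_lambda _ fun l => ha_meas k l).prodMk ((hi_meas k).prodMk (hj_meas k))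
  have hx : ∀ k ≤ K, ∀ ω, x k ω = iter (J ω) k (xt ω) := by
    intro k
    induction k with
    | zero => simp [iter, paramIter, hx0]
    | succ k ih =>
      intro hk ω
      have hk' : k < K := hk
      rw [hrec k hk']
      simp [ih hk'.le, iter, paramIter, hk', step, svrgDirection, J]
  have hepoch : ∀ z, (K : ℝ)⁻¹ * ∑ k ∈ Finset.range K, 𝔼 θ, ‖iter θ k z - xstar‖ ^ 2
      ≤ β1 / β2 * ‖z - xstar‖ ^ 2 := by
    intro z
    have h := mul_sum_expect_paramIter_le (K := K) (V := fun y => ‖y - xstar‖ ^ 2)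
      (fun _ => by positivity)
      (expect_norm_svrg_step_sub_sq_le (A := A) hm hn hA hBG hBGb
        (norm_sub_le_of_jacobian_bound hDG hBGb) hLFb hLf hLfb hμf hγpos hgrad
        (mul_norm_sub_sq_le_inner_gradf hsc hgrad) z) z
    rw [← hβ2] at h
    rw [div_mul_eq_mul_div, le_div_iff₀ hβpos, mul_assoc, inv_mul_le_iff₀ hK0, mul_comm _ β2]
    refine h.trans_eq ?_
    rw [hβ1]
    field_simp
    ring
  have hcont : ∀ θ k, Continuous fun z => ‖iter θ k z - xstar‖ ^ 2 := by
    intro θ k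
    have hgFc : ∀ i, Continuous (gF i) := fun i =>
      (LipschitzWith.of_dist_le_mul (K := ⟨LF, hLF.le⟩) fun u v => by
        rw [dist_eq_norm, dist_eq_norm]
        exact hLFb i u v).continuous
    have hDGc : ∀ j, Continuous (DG j) := fun j => by
      rw [← funext fun y => (hDG j y).fderiv]
      exact (hGc j).continuous_fderiv one_ne_zero
    have hstep : ∀ t, Continuous fun p : EuclideanSpace ℝ (Fin N) × EuclideanSpace ℝ (Fin N) =>
        step p.1 p.2 t := fun t =>
      continuous_snd.sub
        ((continuous_svrgDirection (fun j => (hGc j).continuous) hDGc hgFc t).const_smul γ)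
    exact ((continuous_paramIter hstep θ k).sub continuous_const).norm.pow 2
  have hint0 : Integrable (fun ω => ‖xt ω - xstar‖ ^ 2) μ :=
    (hxt.sub (memLp_const xstar)).integrable_norm_pow two_ne_zero
  have hint : ∀ k < K, ∀ θ, Integrable (fun ω => ‖iter θ k (xt ω) - xstar‖ ^ 2) μ := by
    intro k hk θ
    refine (hint0.const_mul
      (Fintype.card (Fin K → (Fin A → Fin m) × Fin n × Fin m) * (K * (β1 / β2)))).mono'
      ((hcont θ k).comp_aestronglyMeasurable hxt.1) (.of_forall fun ω => ?_)
    rw [Real.norm_of_nonneg (by positivity)]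
    calc ‖iter θ k (xt ω) - xstar‖ ^ 2 ≤ ∑ θ, ‖iter θ k (xt ω) - xstar‖ ^ 2 :=
          Finset.single_le_sum (f := fun θ => ‖iter θ k (xt ω) - xstar‖ ^ 2)
            (fun _ _ => by positivity) (Finset.mem_univ θ)
      _ = Fintype.card (Fin K → (Fin A → Fin m) × Fin n × Fin m)
            * 𝔼 θ, ‖iter θ k (xt ω) - xstar‖ ^ 2 := (Fintype.card_mul_expect _).symm
      _ ≤ Fintype.card (Fin K → (Fin A → Fin m) × Fin n × Fin m)
            * (K * (β1 / β2 * ‖xt ω - xstar‖ ^ 2)) := by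
          refine mul_le_mul_of_nonneg_left ?_ (by positivity)
          refine le_trans ?_ ((inv_mul_le_iff₀ hK0).1 (hepoch (xt ω)))
          exact Finset.single_le_sum
            (f := fun k => 𝔼 θ, ‖iter θ k (xt ω) - xstar‖ ^ 2)
            (fun _ _ => Finset.expect_nonneg fun _ _ => by positivity) (Finset.mem_range.2 hk)
      _ = _ := by ring
  have hlaw : ∀ k < K, ∫ ω, ‖x k ω - xstar‖ ^ 2 ∂μ
      = ∫ ω, 𝔼 θ, ‖iter θ k (xt ω) - xstar‖ ^ 2 ∂μ := by
    intro k hk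
    simp only [hx k hk.le]
    rw [integral_comp_eq_expect_integral_of_indepFun (Z := xt)
      (Φ := fun θ z => ‖iter θ k z - xstar‖ ^ 2) hJ (indepFun_indices hindep)
      (measure_indices_eq ha_unif hi_unif hj_unif hidx_indep) (fun θ => hcont θ k) (hint k hk)]
    simp only [Fintype.expect_eq_sum_div_card, integral_div]
    rw [integral_finsetSum _ fun θ _ => hint k hk θ]
  have hint' : ∀ k ∈ Finset.range K,
      Integrable (fun ω => 𝔼 θ, ‖iter θ k (xt ω) - xstar‖ ^ 2) μ := by
    intro k hk
    simp only [Fintype.expect_eq_sum_div_card]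
    exact (integrable_finsetSum _ fun θ _ => hint k (Finset.mem_range.1 hk) θ).div_const _
  rw [Finset.sum_congr rfl fun k hk => hlaw k (Finset.mem_range.1 hk),
    ← integral_finsetSum _ hint', ← integral_const_mul, ← integral_const_mul]
  exact integral_mono ((integrable_finsetSum _ hint').const_mul _) (hint0.const_mul _)
    fun ω => hepoch (xt ω)
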